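/- arXiv:1911.06889 — 2 statements merged into one kernel-verified Lean document; each statement's English description precedes it below -/
import Mathlib

section
/- For every n ≥ 1, every permutation σ of [n], every c : {0,1,…,n} → {0,1}, every 0 ≤ i ≤ n, and every S ⊆ [n] with R_i ⊆ S, one has f_σ^c(S) ≤ (|S| − i)·(n + 2 − i). -/
open scoped Classical

/-- The important set `R_i = {σ(1), …, σ(i)}`, for `0 ≤ i ≤ n`. -/
noncomputable def impSet (n : ℕ) (σ : Equiv.Perm (Fin n)) (i : ℕ) : Finset (Fin n) :=
  Finset.univ.filter (fun x => (σ.symm x : ℕ) < i)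

/-- `jS n σ S` is the largest `j ≤ n` with `R_j ⊆ S` (well-defined since `R_0 = ∅`). -/
noncomputable def jS (n : ℕ) (σ : Equiv.Perm (Fin n)) (S : Finset (Fin n)) : ℕ :=
  Nat.findGreatest (fun j => impSet n σ j ⊆ S) n

/-- The function `f_σ^c`: equal to `-c_i` on the important set `R_i`
(note `|R_i| = i`), and `(|S| - j(S)) * (n + 2 - j(S))` on unimportant sets. -/
noncomputable def fsc (n : ℕ) (σ : Equiv.Perm (Fin n)) (c : ℕ → ℝ)
    (S : Finset (Fin n)) : ℝ :=
  if ∃ i ≤ n, S = impSet n σ i then -(c S.card)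
  else ((S.card : ℝ) - (jS n σ S : ℕ)) * ((n : ℝ) + 2 - (jS n σ S : ℕ))

theorem card_impSet (n : ℕ) (σ : Equiv.Perm (Fin n)) {i : ℕ} (hi : i ≤ n) :
    (impSet n σ i).card = i := by
  have h : (impSet n σ i).map σ.symm.toEmbedding =
      Finset.univ.filter (fun x : Fin n => (x : ℕ) < i) := by
    ext x
    simp [impSet]
  rw [← Finset.card_map σ.symm.toEmbedding, h, Fin.card_filter_val_lt, min_eq_right hi]

theorem le_card_of_impSet_subset {n : ℕ} {σ : Equiv.Perm (Fin n)} {i : ℕ} (hi : i ≤ n)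
    {S : Finset (Fin n)} (hS : impSet n σ i ⊆ S) : i ≤ S.card :=
  (card_impSet n σ hi).symm.trans_le (Finset.card_le_card hS)

/-- If `R_i ⊆ S` (with `0 ≤ i ≤ n`), then `f_σ^c(S) ≤ (|S| - i)·(n + 2 - i)`. -/
theorem stmt_1 (n : ℕ) (hn : 1 ≤ n) (σ : Equiv.Perm (Fin n)) (c : ℕ → ℝ)
    (hc : ∀ i ≤ n, c i = 0 ∨ c i = 1) (i : ℕ) (hi : i ≤ n)
    (S : Finset (Fin n)) (hS : impSet n σ i ⊆ S) :
    fsc n σ c S ≤ ((S.card : ℝ) - (i : ℕ)) * ((n : ℝ) + 2 - (i : ℕ)) := by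
  have hin : (i : ℝ) ≤ n := by exact_mod_cast hi
  have hiS : (i : ℝ) ≤ S.card := by exact_mod_cast le_card_of_impSet_subset hi hS
  unfold fsc
  split_ifs with h
  · have hcard : S.card ≤ n := by simpa using S.card_le_univ
    have hc_nonneg : 0 ≤ c S.card := by
      rcases hc S.card hcard with h0 | h1
      · exact h0.ge
      · rw [h1]
        exact zero_le_one
    exact (neg_nonpos.mpr hc_nonneg).trans
      (mul_nonneg (sub_nonneg.mpr hiS) (by linarith))
  · have hjn : jS n σ S ≤ n := Nat.findGreatest_le n
    have hij : (i : ℝ) ≤ jS n σ S := by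
      exact_mod_cast Nat.le_findGreatest (P := fun j => impSet n σ j ⊆ S) hi hS
    have hjn' : (jS n σ S : ℝ) ≤ n := by exact_mod_cast hjn
    exact mul_le_mul (by linarith) (by linarith) (by linarith) (by linarith)
end

section
/- Let a ≥ 1, n = 2a + 1, and let G be the undirected graph on vertex set {v, w_1, w'_1, …, w_a, w'_a} whose edges (all of weight 1) are: an edge between v and every other vertex, and an edge between w_i and w'_i for each 1 ≤ i ≤ a. Then the 3a edge-indicator vectors of the cuts {w_i}, {w'_i}, and {w_i, w'_i} (for 1 ≤ i ≤ a) are linearly independent; in particular the span of the indicator vectors of the minimum nontrivial cuts of G has dimension at least 3a = 3(n−1)/2. -/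
open scoped Classical

/-- Weights of the graph on `2a+1` vertices: vertex `0` is `v`, and for
`1 ≤ i ≤ a`, vertex `2i-1` is `w_i` and vertex `2i` is `w'_i`.  There is an
edge (of weight 1) between `v` and every other vertex, and between `w_i` and
`w'_i` for each `i`. -/
noncomputable def gw (a : ℕ) (u u' : Fin (2 * a + 1)) : ℝ :=
  if ((u : ℕ) ≠ (u' : ℕ) ∧ ((u : ℕ) = 0 ∨ (u' : ℕ) = 0)) ∨
     ((u : ℕ) % 2 = 1 ∧ (u' : ℕ) = (u : ℕ) + 1) ∨
     ((u' : ℕ) % 2 = 1 ∧ (u : ℕ) = (u' : ℕ) + 1)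
  then 1 else 0

/-- The cut function of this graph. -/
noncomputable def gcut (a : ℕ) (S : Finset (Fin (2 * a + 1))) : ℝ :=
  ∑ u ∈ S, ∑ u' ∈ Sᶜ, gw a u u'

/-- The vertex `w_i` (for `i : Fin a`, representing the paper's `w_{i+1}`). -/
def wv (a : ℕ) (i : Fin a) : Fin (2 * a + 1) :=
  ⟨2 * (i : ℕ) + 1, by have := i.isLt; omega⟩

/-- The vertex `w'_i`. -/
def wv' (a : ℕ) (i : Fin a) : Fin (2 * a + 1) :=
  ⟨2 * (i : ℕ) + 2, by have := i.isLt; omega⟩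

/-- The cut-indicator vector of `S`, indexed by unordered vertex pairs:
coordinate `{u, u'}` is 1 iff the edge weight is positive and exactly one of
`u, u'` lies in `S`. -/
noncomputable def gcutIndic (a : ℕ) (S : Finset (Fin (2 * a + 1))) :
    Sym2 (Fin (2 * a + 1)) → ℝ :=
  Sym2.lift ⟨fun u u' =>
      if 0 < gw a u u' ∧ ((u ∈ S ∧ u' ∉ S) ∨ (u' ∈ S ∧ u ∉ S)) then 1 else 0,
    fun u u' => by
      dsimp only
      have hg : gw a u u' = gw a u' u := by
        unfold gw
        exact if_congr (by constructor <;> intro hh <;> omega) rfl rfl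
      rw [hg]
      exact if_congr (by tauto) rfl rfl⟩

/-- `S` is a minimum nontrivial cut (global mincut) of the graph. -/
def isMinCut (a : ℕ) (S : Finset (Fin (2 * a + 1))) : Prop :=
  S ≠ ∅ ∧ S ≠ Finset.univ ∧
    ∀ T : Finset (Fin (2 * a + 1)), T ≠ ∅ → T ≠ Finset.univ → gcut a S ≤ gcut a T

lemma gw_eq_zero_or_one (a : ℕ) (u u' : Fin (2 * a + 1)) : gw a u u' = 0 ∨ gw a u u' = 1 := by
  unfold gw
  split_ifs <;> simp

lemma gw_zero_left {a : ℕ} {u : Fin (2 * a + 1)} (hu : u ≠ 0) : gw a 0 u = 1 := by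
  have h : (u : ℕ) ≠ 0 := fun h => hu (Fin.ext h)
  exact if_pos (Or.inl ⟨by simpa using h.symm, Or.inl rfl⟩)

lemma gw_zero_right {a : ℕ} {u : Fin (2 * a + 1)} (hu : u ≠ 0) : gw a u 0 = 1 := by
  have h : (u : ℕ) ≠ 0 := fun h => hu (Fin.ext h)
  exact if_pos (Or.inl ⟨by simpa using h, Or.inr rfl⟩)

lemma gw_wv_wv' (a : ℕ) (i : Fin a) : gw a (wv a i) (wv' a i) = 1 :=
  if_pos (Or.inr (Or.inl ⟨by simp only [wv]; omega, rfl⟩))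

lemma gw_wv'_wv (a : ℕ) (i : Fin a) : gw a (wv' a i) (wv a i) = 1 :=
  if_pos (Or.inr (Or.inr ⟨by simp only [wv]; omega, rfl⟩))

lemma wv_ne_zero (a : ℕ) (i : Fin a) : wv a i ≠ 0 := by
  simp [wv, Fin.ext_iff]

lemma wv'_ne_zero (a : ℕ) (i : Fin a) : wv' a i ≠ 0 := by
  simp [wv', Fin.ext_iff]

lemma wv_inj {a : ℕ} {i j : Fin a} : wv a i = wv a j ↔ i = j := by
  simp only [wv, Fin.ext_iff]; omega

lemma wv'_inj {a : ℕ} {i j : Fin a} : wv' a i = wv' a j ↔ i = j := by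
  simp only [wv', Fin.ext_iff]; omega

lemma wv_ne_wv' (a : ℕ) (i j : Fin a) : wv a i ≠ wv' a j := by
  simp only [wv, wv', ne_eq, Fin.ext_iff]; omega

/-- Every vertex other than `0` has a neighbour other than `0`. -/
lemma exists_partner {a : ℕ} {u : Fin (2 * a + 1)} (hu : u ≠ 0) :
    ∃ p : Fin (2 * a + 1), p ≠ 0 ∧ p ≠ u ∧ gw a u p = 1 ∧ gw a p u = 1 := by
  have h0 : (u : ℕ) ≠ 0 := fun h => hu (Fin.ext h)
  have hlt := u.isLt
  rcases Nat.even_or_odd' (u : ℕ) with ⟨k, hk | hk⟩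
  · have hi : u = wv' a ⟨k - 1, by omega⟩ := by simp only [wv', Fin.ext_iff]; omega
    rw [hi]
    exact ⟨wv a _, wv_ne_zero a _, wv_ne_wv' a _ _, gw_wv'_wv a _, gw_wv_wv' a _⟩
  · have hi : u = wv a ⟨k, by omega⟩ := by simp only [wv, Fin.ext_iff]; omega
    rw [hi]
    exact ⟨wv' a _, wv'_ne_zero a _, (wv_ne_wv' a _ _).symm, gw_wv_wv' a _, gw_wv'_wv a _⟩

lemma gcut_eq_card (a : ℕ) (S : Finset (Fin (2 * a + 1))) :
    gcut a S = (((S ×ˢ Sᶜ).filter fun e => gw a e.1 e.2 = 1).card : ℝ) := by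
  rw [gcut, ← Finset.sum_product', Finset.card_filter]
  push_cast
  refine Finset.sum_congr rfl fun e _ => ?_
  rcases gw_eq_zero_or_one a e.1 e.2 with h | h <;> simp [h]

lemma two_le_gcut_of_pair {a : ℕ} {S : Finset (Fin (2 * a + 1))}
    {x y x' y' : Fin (2 * a + 1)} (hne : (x, y) ≠ (x', y'))
    (hx : x ∈ S) (hy : y ∉ S) (hxy : gw a x y = 1)
    (hx' : x' ∈ S) (hy' : y' ∉ S) (hxy' : gw a x' y' = 1) : 2 ≤ gcut a S := by
  rw [gcut_eq_card]
  refine Nat.ofNat_le_cast.2 ((Finset.card_pair hne).ge.trans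
    (Finset.card_le_card fun e he => ?_))
  rcases Finset.mem_insert.1 he with rfl | he
  · simp [hx, hy, hxy]
  · rw [Finset.mem_singleton.1 he]
    simp [hx', hy', hxy']

lemma two_le_gcut {a : ℕ} {S : Finset (Fin (2 * a + 1))} (h₀ : S ≠ ∅) (h₁ : S ≠ Finset.univ) :
    2 ≤ gcut a S := by
  by_cases hv : (0 : Fin (2 * a + 1)) ∈ S
  · obtain ⟨u, hu⟩ : ∃ u, u ∉ S := by
      by_contra! h
      exact h₁ (Finset.eq_univ_iff_forall.2 h)
    have hu0 : u ≠ 0 := fun h => hu (h ▸ hv)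
    obtain ⟨p, hp0, hpu, -, hw⟩ := exists_partner hu0
    by_cases hp : p ∈ S
    · exact two_le_gcut_of_pair (by simp [hp0.symm]) hv hu (gw_zero_left hu0) hp hu hw
    · exact two_le_gcut_of_pair (by simp [hpu.symm]) hv hu (gw_zero_left hu0) hv hp
        (gw_zero_left hp0)
  · obtain ⟨u, hu⟩ := Finset.nonempty_iff_ne_empty.2 h₀
    have hu0 : u ≠ 0 := fun h => hv (h ▸ hu)
    obtain ⟨p, hp0, hpu, hw, -⟩ := exists_partner hu0
    by_cases hp : p ∈ S
    · exact two_le_gcut_of_pair (by simp [hpu.symm]) hu hv (gw_zero_right hu0) hp hv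
        (gw_zero_right hp0)
    · exact two_le_gcut_of_pair (by simp [hp0.symm]) hu hv (gw_zero_right hu0) hu hp hw

lemma gcut_le_two {a : ℕ} {S : Finset (Fin (2 * a + 1))} (e e' : Fin (2 * a + 1) × Fin (2 * a + 1))
    (h : ∀ x ∈ S, ∀ y ∉ S, gw a x y = 1 → (x, y) = e ∨ (x, y) = e') : gcut a S ≤ 2 := by
  rw [gcut_eq_card]
  have hsub : ((S ×ˢ Sᶜ).filter fun e => gw a e.1 e.2 = 1) ⊆ {e, e'} := by
    rintro ⟨x, y⟩ hxy
    simp only [Finset.mem_filter, Finset.mem_product, Finset.mem_compl] at hxy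
    simpa using h x hxy.1.1 y hxy.1.2 hxy.2
  exact_mod_cast (Finset.card_le_card hsub).trans Finset.card_le_two

lemma isMinCut_of_gcut_le_two {a : ℕ} {S : Finset (Fin (2 * a + 1))} (hS : S.Nonempty)
    (hv : (0 : Fin (2 * a + 1)) ∉ S) (h : gcut a S ≤ 2) : isMinCut a S :=
  ⟨hS.ne_empty, fun hu => hv (hu ▸ Finset.mem_univ _), fun _ h₀ h₁ => h.trans (two_le_gcut h₀ h₁)⟩

lemma gw_wv_eq_one {a : ℕ} {i : Fin a} {y : Fin (2 * a + 1)} (h : gw a (wv a i) y = 1) :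
    y = 0 ∨ y = wv' a i := by
  unfold gw at h
  split_ifs at h with hw
  · simp only [wv, wv', Fin.ext_iff, Fin.val_zero] at hw ⊢
    omega
  · exact absurd h zero_ne_one

lemma gw_wv'_eq_one {a : ℕ} {i : Fin a} {y : Fin (2 * a + 1)} (h : gw a (wv' a i) y = 1) :
    y = 0 ∨ y = wv a i := by
  unfold gw at h
  split_ifs at h with hw
  · simp only [wv, wv', Fin.ext_iff, Fin.val_zero] at hw ⊢
    omega
  · exact absurd h zero_ne_one

lemma isMinCut_wv (a : ℕ) (i : Fin a) : isMinCut a {wv a i} := by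
  refine isMinCut_of_gcut_le_two (by simp) (by simpa using (wv_ne_zero a i).symm)
    (gcut_le_two (wv a i, 0) (wv a i, wv' a i) fun x hx y _ h => ?_)
  rw [Finset.mem_singleton] at hx
  subst hx
  simpa using gw_wv_eq_one h

lemma isMinCut_wv' (a : ℕ) (i : Fin a) : isMinCut a {wv' a i} := by
  refine isMinCut_of_gcut_le_two (by simp) (by simpa using (wv'_ne_zero a i).symm)
    (gcut_le_two (wv' a i, 0) (wv' a i, wv a i) fun x hx y _ h => ?_)
  rw [Finset.mem_singleton] at hx
  subst hx
  simpa using gw_wv'_eq_one h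

lemma isMinCut_pair (a : ℕ) (i : Fin a) : isMinCut a {wv a i, wv' a i} := by
  refine isMinCut_of_gcut_le_two (by simp)
    (by simpa using ⟨(wv_ne_zero a i).symm, (wv'_ne_zero a i).symm⟩)
    (gcut_le_two (wv a i, 0) (wv' a i, 0) fun x hx y hy h => ?_)
  simp only [Finset.mem_insert, Finset.mem_singleton, not_or] at hx hy
  rcases hx with rfl | rfl
  · exact Or.inl (by simpa [hy.2] using gw_wv_eq_one h)
  · exact Or.inr (by simpa [hy.1] using gw_wv'_eq_one h)

lemma gcutIndic_mk_of_gw_eq_one {a : ℕ} (S : Finset (Fin (2 * a + 1))) {u u' : Fin (2 * a + 1)}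
    (h : gw a u u' = 1) :
    gcutIndic a S s(u, u') = if (u ∈ S ∧ u' ∉ S) ∨ (u' ∈ S ∧ u ∉ S) then 1 else 0 := by
  simp [gcutIndic, h]

lemma linearIndependent_gcutIndic (a : ℕ) :
    LinearIndependent ℝ (fun p : Fin a × Fin 3 =>
      gcutIndic a (if p.2 = 0 then {wv a p.1}
        else if p.2 = 1 then {wv' a p.1} else {wv a p.1, wv' a p.1})) := by
  rw [Fintype.linearIndependent_iff]
  intro g hg
  have coord (i : Fin a) := congrFun hg s(0, wv a i)
  have coord' (i : Fin a) := congrFun hg s(0, wv' a i)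
  have coord'' (i : Fin a) := congrFun hg s(wv a i, wv' a i)
  simp only [Fintype.sum_prod_type, Fin.sum_univ_three, Finset.sum_apply,
    Pi.smul_apply, Pi.zero_apply, gcutIndic_mk_of_gw_eq_one _ (gw_zero_left (wv_ne_zero a _)),
    gcutIndic_mk_of_gw_eq_one _ (gw_zero_left (wv'_ne_zero a _)),
    gcutIndic_mk_of_gw_eq_one _ (gw_wv_wv' a _)] at coord coord' coord''
  simp [wv_inj, wv'_inj, wv_ne_wv', (wv_ne_wv' a _ _).symm, (wv_ne_zero a _).symm,
    (wv'_ne_zero a _).symm, Finset.sum_add_distrib] at coord coord' coord''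
  rintro ⟨i, k⟩
  have h := coord i
  have h' := coord' i
  have h'' := coord'' i
  fin_cases k <;> simp <;> linarith

/-- The `3a` indicator vectors of the cuts `{w_i}`, `{w'_i}`, `{w_i, w'_i}`
are linearly independent; in particular the span of the indicator vectors of
the minimum nontrivial cuts has dimension at least `3a`. -/
theorem stmt_13 (a : ℕ) (ha : 1 ≤ a) :
    LinearIndependent ℝ (fun p : Fin a × Fin 3 =>
      gcutIndic a (if p.2 = 0 then {wv a p.1}
        else if p.2 = 1 then {wv' a p.1} else {wv a p.1, wv' a p.1})) ∧
    3 * a ≤ Module.finrank ℝ (Submodule.span ℝ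
      {x : Sym2 (Fin (2 * a + 1)) → ℝ |
        ∃ S : Finset (Fin (2 * a + 1)), isMinCut a S ∧ x = gcutIndic a S}) := by
  have hli := linearIndependent_gcutIndic a
  refine ⟨hli, ?_⟩
  calc 3 * a = Fintype.card (Fin a × Fin 3) := by simp [mul_comm]
    _ = Module.finrank ℝ (Submodule.span ℝ (Set.range _)) := (finrank_span_eq_card hli).symm
    _ ≤ _ := by
      refine Submodule.finrank_mono (Submodule.span_mono ?_)
      rintro _ ⟨⟨i, k⟩, rfl⟩
      refine ⟨_, ?_, rfl⟩
      dsimp only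
      split_ifs
      exacts [isMinCut_wv a i, isMinCut_wv' a i, isMinCut_pair a i]
end
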